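/- arXiv:2211.11827 — 2 statements merged into one kernel-verified Lean document; each statement's English description precedes it below -/
import Mathlib

section
/- Let (Ω, 𝓕, μ) be a probability space, let E and F be measurable spaces, let X, X̂ : Ω → E and D : E → F be measurable, and set Y = D ∘ X. If the law of X̂ equals the law of X (i.e. the pushforward measures Map X̂ μ and Map X μ coincide) and D(X̂ ω) = Y ω for μ-almost every ω (perfect consistency), then the joint law of (X̂, Y) equals the joint law of (X, Y), i.e. the pushforward of μ under ω ↦ (X̂ ω, Y ω) equals the pushforward of μ under ω ↦ (X ω, Y ω). -/
open MeasureTheory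

/-- A perceptually perfect (`Law(X̂) = Law(X)`) and perfectly consistent
(`D ∘ X̂ = Y` a.s.) estimator `X̂` has the same joint law with `Y = D ∘ X`
as `X` does, i.e. it is a posterior sampler. -/
theorem posterior_sampler_of_perfect_perception_of_consistent
    {Ω E F : Type*} [MeasurableSpace Ω] [MeasurableSpace E] [MeasurableSpace F]
    (μ : Measure Ω) [IsProbabilityMeasure μ]
    (X Xhat : Ω → E) (D : E → F) (Y : Ω → F)
    (hX : Measurable X) (hXhat : Measurable Xhat) (hD : Measurable D)
    (hY : Y = D ∘ X)
    (hperc : Measure.map Xhat μ = Measure.map X μ)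
    (hcons : ∀ᵐ ω ∂μ, D (Xhat ω) = Y ω) :
    Measure.map (fun ω => (Xhat ω, Y ω)) μ = Measure.map (fun ω => (X ω, Y ω)) μ := by
  subst hY
  have hgraph : Measurable fun x => (x, D x) := measurable_id.prodMk hD
  calc Measure.map (fun ω => (Xhat ω, (D ∘ X) ω)) μ
      = Measure.map ((fun x => (x, D x)) ∘ Xhat) μ := by
        refine Measure.map_congr ?_
        filter_upwards [hcons] with ω hω
        simp [hω]
    _ = Measure.map ((fun x => (x, D x)) ∘ X) μ := by
        rw [← Measure.map_map hgraph hXhat, hperc, Measure.map_map hgraph hX]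
end

section
/- Let (Ω, 𝓕, μ) be a probability space, let E be a standard Borel space, F a countably generated measurable space, let X, X̂ : Ω → E and D : E → F be measurable, and set Y = D ∘ X. If the law of X̂ equals the law of X and D(X̂ ω) = Y ω for μ-almost every ω, then the regular conditional distribution of X̂ given Y equals the regular conditional distribution of X given Y: condDistrib X̂ Y μ y = condDistrib X Y μ y for (Map Y μ)-almost every y. -/
open MeasureTheory ProbabilityTheory

/-- A perceptually perfect (`Law(X̂) = Law(X)`) and perfectly consistent
(`D ∘ X̂ = Y` a.s.) estimator `X̂` has the same regular conditional distribution
given `Y = D ∘ X` as `X` does: it is a posterior sampler. -/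
theorem condDistrib_eq_of_perfect_perception_of_consistent
    {Ω E F : Type*} [MeasurableSpace Ω]
    [MeasurableSpace E] [StandardBorelSpace E] [Nonempty E]
    [MeasurableSpace F] [MeasurableSpace.CountablyGenerated F]
    (μ : Measure Ω) [IsProbabilityMeasure μ]
    (X Xhat : Ω → E) (D : E → F) (Y : Ω → F)
    (hX : Measurable X) (hXhat : Measurable Xhat) (hD : Measurable D)
    (hY : Y = D ∘ X)
    (hperc : Measure.map Xhat μ = Measure.map X μ)
    (hcons : ∀ᵐ ω ∂μ, D (Xhat ω) = Y ω) :
    ∀ᵐ y ∂(Measure.map Y μ), condDistrib Xhat Y μ y = condDistrib X Y μ y := by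
  subst hY
  have hgraph : Measurable fun x ↦ (D x, x) := hD.prodMk measurable_id
  have hjoint : μ.map (fun ω ↦ ((D ∘ X) ω, Xhat ω)) = μ.map (fun ω ↦ ((D ∘ X) ω, X ω)) :=
    calc μ.map (fun ω ↦ ((D ∘ X) ω, Xhat ω))
        = μ.map ((fun x ↦ (D x, x)) ∘ Xhat) :=
          Measure.map_congr (hcons.mono fun ω hω ↦ by simp [hω])
      _ = μ.map ((fun x ↦ (D x, x)) ∘ X) := by
          rw [← Measure.map_map hgraph hXhat, hperc, Measure.map_map hgraph hX]
  refine condDistrib_ae_eq_of_measure_eq_compProd _ hXhat.aemeasurable ?_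
  rw [compProd_map_condDistrib hX.aemeasurable, hjoint]
end
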